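/- Let d ∈ ℕ, let b₁,…,b_d ∈ C³([0,1]^d,ℝ) satisfy for all i ∈ {1,…,d} and all x = (x₁,…,x_d) ∈ [0,1]^d with x_i ∈ {0,1} that (−1)^{x_i} b_i(x) ≥ 0, and let y be the associated flow. Assume additionally that for every t ∈ [0,∞) the map x ↦ y(t,x) is continuously differentiable on [0,1]^d with partial derivatives jointly continuous in (t,x). Then for every j ∈ {1,…,d}, every t ∈ [0,∞), and every x ∈ [0,1]^d it holds that Σ_{i=1}^d |∂y_i/∂x_j(t,x)| ≤ e^{λ₁ t}. -/

import Mathlib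

open MeasureTheory Filter

noncomputable section

/-- The unit cube `[0,1]^d` in `ℝ^d`. -/
def cube (d : ℕ) : Set (Fin d → ℝ) := Set.univ.pi fun _ => Set.Icc (0:ℝ) 1

/-- Partial derivative in coordinate `i` (within `[0,1]`, i.e. one-sided at the boundary). -/
def pd (d : ℕ) (i : Fin d) (g : (Fin d → ℝ) → ℝ) : (Fin d → ℝ) → ℝ :=
  fun x => derivWithin (fun t => g (Function.update x i t)) (Set.Icc (0:ℝ) 1) (x i)

/-- Iterated partial derivative `∂^α` (coordinates applied in a fixed order). -/
def mderiv (d : ℕ) (α : Fin d → ℕ) (f : (Fin d → ℝ) → ℝ) : (Fin d → ℝ) → ℝ :=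
  List.foldr (fun i g => (pd d i)^[α i] g) f (List.finRange d)

/-- `f ∈ C^m([0,1]^d, ℝ)`: all partial derivatives of order `0` through `m` exist
(one-sidedly at the boundary) and are continuous on the cube. -/
def MemCm (d : ℕ) : ℕ → ((Fin d → ℝ) → ℝ) → Prop
  | 0, f => ContinuousOn f (cube d)
  | m + 1, f => ContinuousOn f (cube d) ∧ ∀ i : Fin d,
      (∀ x ∈ cube d, DifferentiableWithinAt ℝ (fun t => f (Function.update x i t))
        (Set.Icc (0:ℝ) 1) (x i)) ∧
      MemCm d m (pd d i f)

/-- Sup norm over the cube: `‖g‖_∞ = sup_{x ∈ [0,1]^d} |g(x)|`. -/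
def supCube (d : ℕ) (g : (Fin d → ℝ) → ℝ) : ℝ := ⨆ x : cube d, |g x.1|

/-- The `C^m`-norm: `max_{|α| ≤ m} sup_{x ∈ [0,1]^d} |∂^α f(x)|`. -/
def CmNorm (d m : ℕ) (f : (Fin d → ℝ) → ℝ) : ℝ :=
  ⨆ α : {α : Fin d → ℕ // (∑ i, α i) ≤ m}, supCube d (mderiv d α.1 f)

/-- `λ_m := max_{0 < |α| ≤ m} ∑_i ‖∂^α b_i‖_∞`. -/
def lamNorm (d m : ℕ) (b : Fin d → (Fin d → ℝ) → ℝ) : ℝ :=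
  ⨆ α : {α : Fin d → ℕ // 0 < (∑ i, α i) ∧ (∑ i, α i) ≤ m},
    ∑ i, supCube d (mderiv d α.1 (b i))

lemma isCompact_cube (d : ℕ) : IsCompact (cube d) :=
  isCompact_univ_pi fun _ => isCompact_Icc

lemma update_mem_cube {d : ℕ} {x : Fin d → ℝ} (hx : x ∈ cube d) (k : Fin d) {t : ℝ}
    (ht : t ∈ Set.Icc (0:ℝ) 1) : Function.update x k t ∈ cube d := by
  intro i _
  by_cases h : i = k
  · subst h; simpa using ht
  · simpa [h] using hx i trivial

lemma MemCm.continuousOn {d m : ℕ} {f : (Fin d → ℝ) → ℝ} (hf : MemCm d m f) :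
    ContinuousOn f (cube d) := by
  cases m with
  | zero => exact hf
  | succ m => exact hf.1

lemma abs_le_supCube {d : ℕ} {g : (Fin d → ℝ) → ℝ} (hg : ContinuousOn g (cube d))
    {x : Fin d → ℝ} (hx : x ∈ cube d) : |g x| ≤ supCube d g := by
  obtain ⟨C, hC⟩ := (isCompact_cube d).exists_bound_of_continuousOn hg
  exact le_ciSup (f := fun z : cube d => |g z.1|)
    ⟨C, by rintro _ ⟨z, rfl⟩; exact hC z.1 z.2⟩ ⟨x, hx⟩

lemma supCube_nonneg (d : ℕ) (g : (Fin d → ℝ) → ℝ) : 0 ≤ supCube d g :=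
  Real.iSup_nonneg fun _ => abs_nonneg _

lemma foldr_pd_single {d : ℕ} (k : Fin d) (f : (Fin d → ℝ) → ℝ) (l : List (Fin d))
    (hl : l.Nodup) :
    List.foldr (fun i g => (pd d i)^[(Pi.single k 1 : Fin d → ℕ) i] g) f l
      = if k ∈ l then pd d k f else f := by
  induction l with
  | nil => simp
  | cons a l ih =>
    rw [List.nodup_cons] at hl
    rw [List.foldr_cons, ih hl.2]
    by_cases h : a = k
    · subst h; simp [hl.1]
    · simp [h, Ne.symm h]

lemma mderiv_single {d : ℕ} (k : Fin d) (f : (Fin d → ℝ) → ℝ) :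
    mderiv d (Pi.single k 1) f = pd d k f := by
  rw [mderiv, foldr_pd_single k f _ (List.nodup_finRange d)]
  simp

lemma sum_supCube_pd_le_lamNorm (d : ℕ) (b : Fin d → (Fin d → ℝ) → ℝ) (k : Fin d) :
    ∑ i, supCube d (pd d k (b i)) ≤ lamNorm d 1 b := by
  have hfin : Finite {α : Fin d → ℕ // 0 < (∑ i, α i) ∧ (∑ i, α i) ≤ 1} := by
    refine Set.Finite.subset (Set.finite_Iic (1 : Fin d → ℕ)) ?_
    rintro α ⟨-, hα⟩ i
    exact (Finset.single_le_sum (fun _ _ => Nat.zero_le _) (Finset.mem_univ i)).trans hα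
  have h := le_ciSup (f := fun α : {α : Fin d → ℕ // 0 < (∑ i, α i) ∧ (∑ i, α i) ≤ 1} =>
    ∑ i, supCube d (mderiv d α.1 (b i))) (Set.finite_range _).bddAbove
    ⟨Pi.single k 1, by simp, by simp⟩
  simpa only [mderiv_single, lamNorm] using h

lemma lamNorm_nonneg (d m : ℕ) (b : Fin d → (Fin d → ℝ) → ℝ) : 0 ≤ lamNorm d m b :=
  Real.iSup_nonneg fun _ => Finset.sum_nonneg fun _ _ => supCube_nonneg _ _

lemma abs_sub_update_le {d m : ℕ} {f : (Fin d → ℝ) → ℝ} (hf : MemCm d (m + 1) f)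
    {x : Fin d → ℝ} (hx : x ∈ cube d) (k : Fin d) {t : ℝ} (ht : t ∈ Set.Icc (0:ℝ) 1) :
    |f (Function.update x k t) - f x| ≤ supCube d (pd d k f) * |t - x k| := by
  have h := (convex_Icc (0:ℝ) 1).norm_image_sub_le_of_norm_derivWithin_le
    (f := fun s => f (Function.update x k s)) (C := supCube d (pd d k f)) (x := x k) (y := t)
    (fun s hs => by
      simpa using (hf.2 k).1 _ (update_mem_cube hx k hs))
    (fun s hs => by
      simpa [pd] using abs_le_supCube (hf.2 k).2.continuousOn (update_mem_cube hx k hs))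
    (hx k trivial) ht
  simpa using h

lemma abs_sub_le_sum_supCube_pd {d m : ℕ} {f : (Fin d → ℝ) → ℝ} (hf : MemCm d (m + 1) f)
    {u v : Fin d → ℝ} (hu : u ∈ cube d) (hv : v ∈ cube d) :
    |f u - f v| ≤ ∑ k, supCube d (pd d k f) * |u k - v k| := by
  have key : ∀ s : Finset (Fin d),
      |f (s.piecewise u v) - f v| ≤ ∑ k ∈ s, supCube d (pd d k f) * |u k - v k| := by
    intro s
    induction s using Finset.induction_on with
    | empty => simp
    | insert k s hk ih =>
      have hmem : s.piecewise u v ∈ cube d := by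
        intro i _
        by_cases h : i ∈ s
        · simpa [h] using hu i trivial
        · simpa [h] using hv i trivial
      have h := abs_sub_update_le hf hmem k (hu k trivial)
      rw [Finset.piecewise_eq_of_notMem _ _ _ hk] at h
      rw [Finset.piecewise_insert, Finset.sum_insert hk]
      exact (abs_sub_le _ (f (s.piecewise u v)) _).trans (add_le_add h ih)
  simpa using key Finset.univ

/-- A vector field of class `C^1` on the cube is `λ₁`-Lipschitz for the `ℓ¹`-norm. -/
lemma sum_abs_sub_le_lamNorm {d m : ℕ} {b : Fin d → (Fin d → ℝ) → ℝ}
    (hb : ∀ i, MemCm d (m + 1) (b i)) {u v : Fin d → ℝ} (hu : u ∈ cube d) (hv : v ∈ cube d) :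
    ∑ i, |b i u - b i v| ≤ lamNorm d 1 b * ∑ k, |u k - v k| :=
  calc ∑ i, |b i u - b i v|
      ≤ ∑ i, ∑ k, supCube d (pd d k (b i)) * |u k - v k| :=
        Finset.sum_le_sum fun i _ => abs_sub_le_sum_supCube_pd (hb i) hu hv
    _ = ∑ k, (∑ i, supCube d (pd d k (b i))) * |u k - v k| := by
        rw [Finset.sum_comm]; simp only [Finset.sum_mul]
    _ ≤ ∑ k, lamNorm d 1 b * |u k - v k| := Finset.sum_le_sum fun k _ =>
        mul_le_mul_of_nonneg_right (sum_supCube_pd_le_lamNorm d b k) (abs_nonneg _)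
    _ = lamNorm d 1 b * ∑ k, |u k - v k| := by rw [Finset.mul_sum]

/-- Trajectories of the integral equation are continuous along times of integrability. -/
lemma continuousOn_of_integral_eq {d : ℕ} {f : (Fin d → ℝ) → ℝ} (hf : ContinuousOn f (cube d))
    {z : ℝ → Fin d → ℝ} (hz : ∀ t, 0 ≤ t → z t ∈ cube d) {c : ℝ} {w : ℝ → ℝ}
    (hflow : ∀ t, 0 ≤ t → w t = c + ∫ s in (0:ℝ)..t, f (z s)) {S : Set ℝ}
    (hS : ∀ t ∈ S, 0 ≤ t ∧ IntervalIntegrable (fun s => f (z s)) volume 0 t) :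
    ContinuousOn w S := by
  obtain ⟨C, hC⟩ := (isCompact_cube d).exists_bound_of_continuousOn hf
  have hlip : LipschitzOnWith C.toNNReal w S := by
    refine LipschitzOnWith.of_dist_le_mul fun p hp q hq => ?_
    rw [Real.dist_eq, Real.dist_eq, hflow p (hS p hp).1, hflow q (hS q hq).1,
      add_sub_add_left_eq_sub,
      intervalIntegral.integral_interval_sub_left (hS p hp).2 (hS q hq).2, ← Real.norm_eq_abs]
    refine intervalIntegral.norm_integral_le_of_norm_le_const fun s hs => ?_
    have hs0 : 0 ≤ s := (le_min (hS q hq).1 (hS p hp).1).trans hs.1.le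
    exact (hC _ (hz s hs0)).trans (Real.le_coe_toNNReal C)
  exact hlip.continuousOn

/-- The integral equation forces its own integrand to be integrable: otherwise the integral takes
the default value zero, which would make the trajectory piecewise continuous. -/
lemma intervalIntegrable_of_integral_eq {d : ℕ} {b : Fin d → (Fin d → ℝ) → ℝ}
    (hb : ∀ i, ContinuousOn (b i) (cube d)) {z : ℝ → Fin d → ℝ}
    (hz : ∀ t, 0 ≤ t → z t ∈ cube d) {x : Fin d → ℝ}
    (hflow : ∀ i t, 0 ≤ t → z t i = x i + ∫ s in (0:ℝ)..t, b i (z s))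
    (i : Fin d) {t : ℝ} (ht : 0 ≤ t) :
    IntervalIntegrable (fun s => b i (z s)) volume 0 t := by
  classical
  let S : Fin d → Set ℝ := fun k =>
    {t | 0 ≤ t ∧ IntervalIntegrable (fun s => b k (z s)) volume 0 t}
  have hSord : ∀ k, (S k).OrdConnected := fun k => ⟨by
    rintro p ⟨hp, -⟩ q ⟨hq, hqi⟩ r ⟨hpr, hrq⟩
    refine ⟨hp.trans hpr, hqi.mono_set ?_⟩
    rw [Set.uIcc_of_le (hp.trans hpr), Set.uIcc_of_le hq]
    exact Set.Icc_subset_Icc_right hrq⟩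
  have hcont : ∀ k, ContinuousOn (fun t => z t k) (S k) :=
    fun k => continuousOn_of_integral_eq (hb k) hz (hflow k) fun _ ht => ht
  let w : ℝ → Fin d → ℝ := fun t k => (S k).piecewise (fun t => z t k) (fun _ => x k) t
  have hw : Measurable w := measurable_pi_lambda _ fun k =>
    (hcont k).measurable_piecewise continuousOn_const (hSord k).measurableSet
  have hzw : ∀ t, 0 ≤ t → z t = w t := by
    intro t ht
    funext k
    by_cases h : t ∈ S k
    · simp [w, h]
    · have hni : ¬ IntervalIntegrable (fun s => b k (z s)) volume 0 t := fun hi => h ⟨ht, hi⟩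
      simp [w, h, hflow k t ht, intervalIntegral.integral_undef hni]
  have hbm : Measurable ((cube d).piecewise (b i) 0) :=
    (hb i).measurable_piecewise continuousOn_const (isCompact_cube d).measurableSet
  obtain ⟨C, hC⟩ := (isCompact_cube d).exists_bound_of_continuousOn (hb i)
  rw [intervalIntegrable_iff_integrableOn_Ioc_of_le ht]
  refine ⟨?_, .restrict_of_bounded (C := C) (by simp) ?_⟩
  · refine (hbm.comp hw).aestronglyMeasurable.congr ?_
    filter_upwards [ae_restrict_mem measurableSet_Ioc] with s hs
    have hzs := hz s hs.1.le
    rw [Function.comp_apply, ← hzw s hs.1.le]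
    exact Set.piecewise_eq_of_mem _ _ _ hzs
  · filter_upwards [ae_restrict_mem measurableSet_Ioc] with s hs
    exact hC _ (hz s hs.1.le)

/-- Solutions of the integral equation are continuous and solve the differential equation. -/
lemma continuousOn_and_hasDerivWithinAt_of_integral_eq {d : ℕ} {b : Fin d → (Fin d → ℝ) → ℝ}
    (hb : ∀ i, ContinuousOn (b i) (cube d)) {z : ℝ → Fin d → ℝ}
    (hz : ∀ t, 0 ≤ t → z t ∈ cube d) {x : Fin d → ℝ}
    (hflow : ∀ i t, 0 ≤ t → z t i = x i + ∫ s in (0:ℝ)..t, b i (z s)) :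
    ContinuousOn z (Set.Ici 0) ∧
      ∀ t, 0 ≤ t → HasDerivWithinAt z (fun i => b i (z t)) (Set.Ici t) t := by
  have hint := fun i t ht => intervalIntegrable_of_integral_eq hb hz hflow i (t := t) ht
  have hcont : ContinuousOn z (Set.Ici 0) :=
    continuousOn_pi.2 fun i =>
      continuousOn_of_integral_eq (hb i) hz (hflow i) fun t ht => ⟨ht, hint i t ht⟩
  refine ⟨hcont, fun t ht => hasDerivWithinAt_pi.2 fun i => ?_⟩
  have hbz : ContinuousOn (fun s => b i (z s)) (Set.Ici 0) := (hb i).comp hcont hz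
  have hsub : Set.Ici t ⊆ Set.Ici (0:ℝ) := Set.Ici_subset_Ici.2 ht
  have hmeas : StronglyMeasurableAtFilter (fun s => b i (z s)) (nhdsWithin t (Set.Ioi t)) :=
    ⟨Set.Ioi t, self_mem_nhdsWithin,
      (hbz.mono (Set.Ioi_subset_Ici_self.trans hsub)).aestronglyMeasurable measurableSet_Ioi⟩
  have hder := intervalIntegral.integral_hasDerivWithinAt_right (s := Set.Ici t)
    (t := Set.Ioi t) (hint i t ht) hmeas
    ((hbz t ht).mono (Set.Ioi_subset_Ici_self.trans hsub))
  exact (hder.const_add (x i)).congr (fun s hs => hflow i s (hsub hs)) (hflow i t ht)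

/-- Stability of the flow in the `ℓ¹`-norm with respect to the initial value. -/
lemma sum_abs_sub_le_of_integral_eq {d m : ℕ} {b : Fin d → (Fin d → ℝ) → ℝ}
    (hb : ∀ i, MemCm d (m + 1) (b i)) {z₁ z₂ : ℝ → Fin d → ℝ}
    (hz₁ : ∀ t, 0 ≤ t → z₁ t ∈ cube d) (hz₂ : ∀ t, 0 ≤ t → z₂ t ∈ cube d)
    {x₁ x₂ : Fin d → ℝ}
    (hflow₁ : ∀ i t, 0 ≤ t → z₁ t i = x₁ i + ∫ s in (0:ℝ)..t, b i (z₁ s))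
    (hflow₂ : ∀ i t, 0 ≤ t → z₂ t i = x₂ i + ∫ s in (0:ℝ)..t, b i (z₂ s))
    {t : ℝ} (ht : 0 ≤ t) :
    ∑ i, |z₁ t i - z₂ t i| ≤ (∑ i, |x₁ i - x₂ i|) * Real.exp (lamNorm d 1 b * t) := by
  have hdist : ∀ p q : PiLp 1 (fun _ : Fin d => ℝ), dist p q = ∑ i, |p i - q i| := by
    intro p q
    rw [PiLp.dist_eq_of_L1]
    simp [Real.dist_eq]
  let e := PiLp.continuousLinearEquiv 1 ℝ (fun _ : Fin d => ℝ)
  have hbc := fun i => (hb i).continuousOn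
  obtain ⟨hc₁, hd₁⟩ := continuousOn_and_hasDerivWithinAt_of_integral_eq hbc hz₁ hflow₁
  obtain ⟨hc₂, hd₂⟩ := continuousOn_and_hasDerivWithinAt_of_integral_eq hbc hz₂ hflow₂
  have hlip : LipschitzOnWith (lamNorm d 1 b).toNNReal
      (fun p : PiLp 1 (fun _ : Fin d => ℝ) => e.symm fun i => b i (e p)) (e ⁻¹' cube d) := by
    refine LipschitzOnWith.of_dist_le_mul fun p hp q hq => ?_
    rw [hdist, hdist, Real.coe_toNNReal _ (lamNorm_nonneg d 1 b)]
    exact sum_abs_sub_le_lamNorm hb hp hq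
  have h := dist_le_of_trajectories_ODE_of_mem (a := 0) (b := t)
    (v := fun _ p => e.symm fun i => b i (e p)) (s := fun _ => e ⁻¹' cube d)
    (f := fun s => e.symm (z₁ s)) (g := fun s => e.symm (z₂ s))
    (δ := ∑ i, |x₁ i - x₂ i|)
    (fun _ _ => hlip)
    (e.symm.continuous.comp_continuousOn (hc₁.mono Set.Icc_subset_Ici_self))
    (fun s hs => by
      simpa [Function.comp_def] using
        e.symm.toContinuousLinearMap.hasFDerivAt.comp_hasDerivWithinAt s (hd₁ s hs.1))
    (fun s hs => by simpa using hz₁ s hs.1)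
    (e.symm.continuous.comp_continuousOn (hc₂.mono Set.Icc_subset_Ici_self))
    (fun s hs => by
      simpa [Function.comp_def] using
        e.symm.toContinuousLinearMap.hasFDerivAt.comp_hasDerivWithinAt s (hd₂ s hs.1))
    (fun s hs => by simpa using hz₂ s hs.1)
    (by
      rw [hdist]
      refine Finset.sum_le_sum fun i _ => le_of_eq ?_
      change |z₁ 0 i - z₂ 0 i| = _
      simp [hflow₁ i 0 le_rfl, hflow₂ i 0 le_rfl])
    t ⟨ht, le_rfl⟩
  rw [hdist, Real.coe_toNNReal _ (lamNorm_nonneg d 1 b), sub_zero] at h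
  exact h

/-- First-order derivative estimate for the flow of the drift ODE:
`∑_{i=1}^d |∂y_i/∂x_j(t,x)| ≤ e^{λ₁ t}`. -/
theorem drift_flow_first_derivative_estimate
    (d : ℕ) (hd : 0 < d)
    (b : Fin d → (Fin d → ℝ) → ℝ)
    (hb : ∀ i : Fin d, MemCm d 3 (b i))
    (hbdry : ∀ i : Fin d, ∀ x ∈ cube d,
      (x i = 0 → 0 ≤ b i x) ∧ (x i = 1 → b i x ≤ 0))
    (y : ℝ → (Fin d → ℝ) → (Fin d → ℝ))
    (hy_cube : ∀ t ∈ Set.Ici (0:ℝ), ∀ x ∈ cube d, y t x ∈ cube d)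
    (hy_flow : ∀ i : Fin d, ∀ t ∈ Set.Ici (0:ℝ), ∀ x ∈ cube d,
      y t x i = x i + ∫ s in (0:ℝ)..t, b i (y s x))
    (hy_C1 : ∀ t ∈ Set.Ici (0:ℝ), ∀ i : Fin d, MemCm d 1 (fun x => y t x i))
    (hy_joint : ∀ i j : Fin d, ContinuousOn
      (fun q : ℝ × (Fin d → ℝ) => pd d j (fun x => y q.1 x i) q.2)
      (Set.Ici (0:ℝ) ×ˢ cube d))
    (j : Fin d) (t : ℝ) (ht : 0 ≤ t) (x : Fin d → ℝ) (hx : x ∈ cube d) :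
    ∑ i : Fin d, |pd d j (fun x' => y t x' i) x| ≤ Real.exp (lamNorm d 1 b * t) := by
  set g : Fin d → ℝ → ℝ := fun i s => y t (Function.update x j s) i with hg
  have hslope : ∀ i, Tendsto (slope (g i) (x j)) (nhdsWithin (x j) (Set.Icc (0:ℝ) 1 \ {x j}))
      (nhds (pd d j (fun x' => y t x' i) x)) := fun i =>
    hasDerivWithinAt_iff_tendsto_slope.1 (((hy_C1 t ht i).2 j).1 x hx).hasDerivWithinAt
  have hne : (nhdsWithin (x j) (Set.Icc (0:ℝ) 1 \ {x j})).NeBot := by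
    have h := uniqueDiffWithinAt_iff_accPt.1
      (uniqueDiffOn_Icc (zero_lt_one' ℝ) (x j) (hx j trivial))
    rwa [accPt_principal_iff_nhdsWithin] at h
  refine le_of_tendsto (tendsto_finsetSum Finset.univ fun i _ => (hslope i).abs) ?_
  filter_upwards [self_mem_nhdsWithin] with s hs
  have hux := update_mem_cube hx j hs.1
  have h := sum_abs_sub_le_of_integral_eq hb (fun r hr => hy_cube r hr _ hux)
    (fun r hr => hy_cube r hr x hx) (fun i r hr => hy_flow i r hr _ hux)
    (fun i r hr => hy_flow i r hr x hx) ht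
  have hsum : ∑ i, |Function.update x j s i - x i| = |s - x j| := by
    rw [Finset.sum_eq_single j (fun i _ hi => by simp [hi]) (by simp)]
    simp
  have hpos : 0 < |s - x j| := abs_pos.2 (sub_ne_zero.2 hs.2)
  rw [hsum] at h
  have heq : ∑ i, |slope (g i) (x j) s|
      = (∑ i, |y t (Function.update x j s) i - y t x i|) / |s - x j| := by
    rw [Finset.sum_div]
    refine Finset.sum_congr rfl fun i _ => ?_
    simp [slope_def_field, hg, abs_div]
  rw [heq, div_le_iff₀ hpos, mul_comm]
  exact h

end
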